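/- arXiv:1601.03123 — 3 statements merged into one kernel-verified Lean document; each statement's English description precedes it below -/
import Mathlib

section
/- Let 0 < l < 1. Then there exists a constant C_l > 0, depending only on l, such that for every λ > 0 and every t > 0, ∫₀^t e^{−(t−τ)λ} τ^{−l} dτ ≤ C_l λ^{−1} t^{−l}. -/
open MeasureTheory Set

/-- Splitting `(0, t)` at `t / 2` bounds the weighted exponential kernel by a sum of two terms,
each with only one non-constant factor. -/
theorem exp_mul_rpow_neg_le {l lam t τ : ℝ} (hl : 0 ≤ l) (hlam : 0 < lam) (ht : 0 < t)
    (hτ : τ ∈ Ioo 0 t) :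
    Real.exp (-(t - τ) * lam) * τ ^ (-l) ≤
      (t / 2) ^ (-l) * Real.exp (-(t - τ) * lam) + 2 / (t * lam) * τ ^ (-l) := by
  obtain ⟨h0, h1⟩ := hτ
  have hexp := Real.exp_pos (-(t - τ) * lam)
  have hpow : 0 < τ ^ (-l) := Real.rpow_pos_of_pos h0 _
  rcases le_total (t / 2) τ with h | h
  · have hle : τ ^ (-l) ≤ (t / 2) ^ (-l) :=
      Real.rpow_le_rpow_of_nonpos (by positivity) h (by linarith)
    have : 0 ≤ 2 / (t * lam) * τ ^ (-l) := by positivity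
    nlinarith
  · have hx : t * lam / 2 ≤ (t - τ) * lam := by nlinarith
    have hle : Real.exp (-(t - τ) * lam) ≤ 2 / (t * lam) := by
      rw [neg_mul, Real.exp_neg, ← inv_div]
      refine inv_anti₀ (by positivity) (hx.trans ?_)
      linarith [Real.add_one_le_exp ((t - τ) * lam)]
    have : 0 ≤ (t / 2) ^ (-l) * Real.exp (-(t - τ) * lam) := by positivity
    nlinarith

theorem integral_exp_neg_sub_mul_le {lam t : ℝ} (hlam : 0 < lam) :
    ∫ τ in (0 : ℝ)..t, Real.exp (-(t - τ) * lam) ≤ lam⁻¹ := by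
  have hderiv : ∀ τ ∈ uIcc 0 t,
      HasDerivAt (fun τ ↦ lam⁻¹ * Real.exp (-(t - τ) * lam)) (Real.exp (-(t - τ) * lam)) τ := by
    intro τ _
    have h := (((((hasDerivAt_id τ).const_sub t).neg).mul_const lam).exp).const_mul lam⁻¹
    refine h.congr_deriv ?_
    simp
    field_simp
  rw [intervalIntegral.integral_eq_sub_of_hasDerivAt hderiv
    (Continuous.intervalIntegrable (by fun_prop) _ _)]
  have : 0 < lam⁻¹ * Real.exp (-(t - 0) * lam) := by positivity
  simpa using this.le

/-- Lemma 3.3, inequality (3.6): for `0 < l < 1` there is a constant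
`C_l > 0` depending only on `l` such that for all `λ > 0` and `t > 0`,
`∫₀ᵗ e^{-(t-τ)λ} τ^{-l} dτ ≤ C_l λ⁻¹ t^{-l}`. -/
theorem time_weighted_kernel_estimate (l : ℝ) (hl0 : 0 < l) (hl1 : l < 1) :
    ∃ C : ℝ, 0 < C ∧ ∀ lam t : ℝ, 0 < lam → 0 < t →
      (∫ τ in Ioo (0 : ℝ) t, Real.exp (-(t - τ) * lam) * τ ^ (-l))
        ≤ C * lam⁻¹ * t ^ (-l) := by
  refine ⟨2 ^ l + 2 / (1 - l), by have := sub_pos.2 hl1; positivity, fun lam t hlam ht ↦ ?_⟩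
  have hexp : IntervalIntegrable (fun τ ↦ Real.exp (-(t - τ) * lam)) volume 0 t :=
    Continuous.intervalIntegrable (by fun_prop) _ _
  have hpow : IntervalIntegrable (fun τ : ℝ ↦ τ ^ (-l)) volume 0 t :=
    intervalIntegral.intervalIntegrable_rpow' (by linarith)
  have hsum := (hexp.const_mul ((t / 2) ^ (-l))).add (hpow.const_mul (2 / (t * lam)))
  calc
    ∫ τ in Ioo (0 : ℝ) t, Real.exp (-(t - τ) * lam) * τ ^ (-l)
      ≤ ∫ τ in Ioo (0 : ℝ) t,
          ((t / 2) ^ (-l) * Real.exp (-(t - τ) * lam) + 2 / (t * lam) * τ ^ (-l)) := by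
        refine integral_mono_of_nonneg ?_
          ((intervalIntegrable_iff_integrableOn_Ioo_of_le ht.le).1 hsum) ?_
        · filter_upwards [ae_restrict_mem measurableSet_Ioo] with τ hτ
          have := hτ.1
          simp only [Pi.zero_apply]
          positivity
        · filter_upwards [ae_restrict_mem measurableSet_Ioo] with τ hτ
          exact exp_mul_rpow_neg_le hl0.le hlam ht hτ
    _ = (t / 2) ^ (-l) * (∫ τ in (0 : ℝ)..t, Real.exp (-(t - τ) * lam)) +
          2 / (t * lam) * ∫ τ in (0 : ℝ)..t, τ ^ (-l) := by
        rw [← integral_Ioc_eq_integral_Ioo, ← intervalIntegral.integral_of_le ht.le,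
          intervalIntegral.integral_add (hexp.const_mul _) (hpow.const_mul _),
          intervalIntegral.integral_const_mul, intervalIntegral.integral_const_mul]
    _ ≤ (t / 2) ^ (-l) * lam⁻¹ + 2 / (t * lam) * (t ^ (-l + 1) / (-l + 1)) := by
        rw [integral_rpow (Or.inl (by linarith)), Real.zero_rpow (by linarith), sub_zero]
        gcongr
        exact integral_exp_neg_sub_mul_le hlam
    _ = (2 ^ l + 2 / (1 - l)) * lam⁻¹ * t ^ (-l) := by
        have hl : 1 - l ≠ 0 := by linarith
        rw [Real.div_rpow ht.le zero_le_two, Real.rpow_neg zero_le_two, div_inv_eq_mul,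
          Real.rpow_add_one ht.ne', neg_add_eq_sub]
        field_simp
end

section
/- Let d ≥ 1, α ∈ (0,1], σ ∈ [0,α), let K satisfy (K1), (K2) and (K3), and let p ≥ 2 be a real number. Let θ : ℝ^d → ℝ be bounded and measurable, and let x ∈ ℝ^d be a point at which both principal values Lθ(x) := lim_{ε→0⁺} ∫_{|y|>ε} (θ(x) − θ(x+y)) K(y) dy and L(|θ|^{p/2})(x) := lim_{ε→0⁺} ∫_{|y|>ε} (|θ(x)|^{p/2} − |θ(x+y)|^{p/2}) K(y) dy exist (finite). Then |θ(x)|^{p/2−2} θ(x) · Lθ(x) ≥ (2/p) · L(|θ|^{p/2})(x) − 2 ∫_{|x−y|≥1} ( |θ(x)|^{p/2} + |θ(y)|^{p/2} ) |K(x−y)| dy, where |θ(x)|^{p/2−2}θ(x) denotes sign(θ(x))·|θ(x)|^{p/2−1}, taken to be 0 when θ(x) = 0. -/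
open MeasureTheory Set Filter

/-- The tangent-line form of Young's inequality for the convex function `t ↦ |t| ^ q`. -/
theorem abs_rpow_sub_le_sign_mul {q : ℝ} (hq : 1 ≤ q) (a b : ℝ) :
    q⁻¹ * (|a| ^ q - |b| ^ q) ≤ Real.sign a * |a| ^ (q - 1) * (a - b) := by
  have hq0 : 0 < q := by linarith
  have hqi : q⁻¹ ≤ 1 := inv_le_one_of_one_le₀ hq
  rcases eq_or_ne a 0 with rfl | ha
  · simp only [abs_zero, Real.zero_rpow hq0.ne', Real.sign_zero, zero_sub, zero_mul]
    have : 0 ≤ q⁻¹ * |b| ^ q := by positivity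
    linarith
  have ha' : 0 < |a| := abs_pos.mpr ha
  have young : |a| ^ (q - 1) * |b| ≤ (1 - q⁻¹) * |a| ^ q + q⁻¹ * |b| ^ q := by
    have h := Real.geom_mean_le_arith_mean2_weighted (sub_nonneg.mpr hqi)
      (inv_nonneg.mpr hq0.le) (Real.rpow_nonneg (abs_nonneg a) q)
      (Real.rpow_nonneg (abs_nonneg b) q) (by ring)
    rwa [← Real.rpow_mul (abs_nonneg a), ← Real.rpow_mul (abs_nonneg b),
      mul_inv_cancel₀ hq0.ne', Real.rpow_one,
      show q * (1 - q⁻¹) = q - 1 by field_simp] at h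
  have hpow : |a| ^ (q - 1) * |a| = |a| ^ q := by
    rw [← Real.rpow_add_one ha'.ne', sub_add_cancel]
  have hsa : Real.sign a * a = |a| := by
    rcases lt_or_gt_of_ne ha with h | h
    · rw [Real.sign_of_neg h, abs_of_neg h]; ring
    · rw [Real.sign_of_pos h, abs_of_pos h]; ring
  have hsb : Real.sign a * b ≤ |b| := by
    rcases lt_or_gt_of_ne ha with h | h
    · rw [Real.sign_of_neg h]; linarith [neg_le_abs b]
    · rw [Real.sign_of_pos h]; linarith [le_abs_self b]
  have hmul := mul_le_mul_of_nonneg_left hsb (Real.rpow_nonneg ha'.le (q - 1))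
  calc q⁻¹ * (|a| ^ q - |b| ^ q) ≤ |a| ^ (q - 1) * |a| - |a| ^ (q - 1) * |b| := by
        rw [hpow]; linarith
    _ ≤ |a| ^ (q - 1) * (Real.sign a * a) - |a| ^ (q - 1) * (Real.sign a * b) := by
        rw [hsa]; linarith
    _ = Real.sign a * |a| ^ (q - 1) * (a - b) := by ring

/-- A kernel of Lévy type is integrable away from the origin. -/
theorem integrableOn_of_integrable_min_one_sq_norm_mul {E : Type*} [NormedAddCommGroup E]
    [MeasurableSpace E] [BorelSpace E] {μ : Measure E} {K : E → ℝ} (hK : Measurable K)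
    (hint : Integrable (fun y => min 1 (‖y‖ ^ 2) * |K y|) μ) {ε : ℝ} (hε : 0 < ε) :
    IntegrableOn K {y | ε < ‖y‖} μ := by
  have hc : 0 < min 1 (ε ^ 2) := lt_min one_pos (by positivity)
  refine Integrable.mono' (hint.integrableOn.const_mul (min 1 (ε ^ 2))⁻¹)
    hK.aestronglyMeasurable ?_
  filter_upwards [ae_restrict_mem (measurableSet_lt measurable_const measurable_norm)] with y hy
  have hy' : ε < ‖y‖ := hy
  have hmin : min 1 (ε ^ 2) ≤ min 1 (‖y‖ ^ 2) := by gcongr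
  rw [Real.norm_eq_abs, inv_mul_eq_div, le_div_iff₀ hc, mul_comm]
  gcongr

/-- pointwise inequality (4.5) in the proof of Lemma 4.2: for a bounded
measurable `θ` and a point `x` where the principal values `Lθ(x)` and `L(|θ|^{p/2})(x)` exist,
`|θ(x)|^{p/2-2}θ(x) · Lθ(x) ≥ (2/p) L(|θ|^{p/2})(x) - 2∫_{|x-y|≥1}(|θ(x)|^{p/2}+|θ(y)|^{p/2})|K(x-y)| dy`. -/
theorem pointwise_levy_inequality
    (d : ℕ) (hd : 1 ≤ d) (α σ c₁ c₂ p : ℝ)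
    (hα0 : 0 < α) (hα1 : α ≤ 1) (hσ0 : 0 ≤ σ) (hσα : σ < α)
    (hc₁ : 0 < c₁) (hc₂ : 1 ≤ c₂) (hp : 2 ≤ p)
    (K : EuclideanSpace ℝ (Fin d) → ℝ)
    (hKmeas : Measurable K)
    (hKsymm : ∀ y : EuclideanSpace ℝ (Fin d), y ≠ 0 → K (-y) = K y)
    (hK1int : Integrable (fun y : EuclideanSpace ℝ (Fin d) => min 1 (‖y‖ ^ 2) * |K y|))
    (hK1 : (∫ y : EuclideanSpace ℝ (Fin d), min 1 (‖y‖ ^ 2) * |K y|) ≤ c₁)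
    (hK2 : ∀ y : EuclideanSpace ℝ (Fin d), 0 < ‖y‖ → ‖y‖ ≤ 1 →
      c₂⁻¹ * ‖y‖ ^ (-((d : ℝ) + α - σ)) ≤ K y ∧ K y ≤ c₂ * ‖y‖ ^ (-((d : ℝ) + α)))
    (hK3 : ∀ y : EuclideanSpace ℝ (Fin d), y ≠ 0 → 0 ≤ K y)
    (θ : EuclideanSpace ℝ (Fin d) → ℝ)
    (hθmeas : Measurable θ)
    (Mθ : ℝ) (hθbdd : ∀ y, |θ y| ≤ Mθ)
    (x : EuclideanSpace ℝ (Fin d))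
    (Lθx LθPx : ℝ)
    (hLθ : Tendsto (fun ε : ℝ =>
        ∫ y in {y : EuclideanSpace ℝ (Fin d) | ε < ‖y‖}, (θ x - θ (x + y)) * K y)
      (nhdsWithin 0 (Ioi 0)) (nhds Lθx))
    (hLθP : Tendsto (fun ε : ℝ =>
        ∫ y in {y : EuclideanSpace ℝ (Fin d) | ε < ‖y‖},
          (|θ x| ^ (p / 2) - |θ (x + y)| ^ (p / 2)) * K y)
      (nhdsWithin 0 (Ioi 0)) (nhds LθPx)) :
    (2 / p) * LθPx
        - 2 * ∫ y in {y : EuclideanSpace ℝ (Fin d) | 1 ≤ ‖x - y‖},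
            (|θ x| ^ (p / 2) + |θ y| ^ (p / 2)) * |K (x - y)|
      ≤ Real.sign (θ x) * |θ x| ^ (p / 2 - 1) * Lθx := by
  have hq : 1 ≤ p / 2 := by linarith
  have hinv : (p / 2)⁻¹ = 2 / p := inv_div p 2
  have htail : 0 ≤ ∫ y in {y : EuclideanSpace ℝ (Fin d) | 1 ≤ ‖x - y‖},
      (|θ x| ^ (p / 2) + |θ y| ^ (p / 2)) * |K (x - y)| :=
    integral_nonneg fun y => by positivity
  have hθshift : Measurable fun y => θ (x + y) := hθmeas.comp (measurable_const_add x)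
  have hmain : 2 / p * LθPx ≤ Real.sign (θ x) * |θ x| ^ (p / 2 - 1) * Lθx := by
    refine le_of_tendsto_of_tendsto (hLθP.const_mul _) (hLθ.const_mul _) ?_
    filter_upwards [self_mem_nhdsWithin] with ε (hε : 0 < ε)
    have hKε := integrableOn_of_integrable_min_one_sq_norm_mul hKmeas hK1int hε
    have hint₁ : IntegrableOn (fun y => (θ x - θ (x + y)) * K y) {y | ε < ‖y‖} := by
      refine hKε.bdd_mul (c := Mθ + Mθ)
        (measurable_const.sub hθshift).aestronglyMeasurable (Eventually.of_forall fun y => ?_)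
      exact (norm_sub_le _ _).trans (add_le_add (hθbdd _) (hθbdd _))
    have hint₂ : IntegrableOn
        (fun y => (|θ x| ^ (p / 2) - |θ (x + y)| ^ (p / 2)) * K y) {y | ε < ‖y‖} := by
      refine hKε.bdd_mul (c := Mθ ^ (p / 2) + Mθ ^ (p / 2))
        (measurable_const.sub (hθshift.abs.pow_const _)).aestronglyMeasurable
        (Eventually.of_forall fun y => ?_)
      have hbound : ∀ z, ‖|θ z| ^ (p / 2)‖ ≤ Mθ ^ (p / 2) := fun z => by
        rw [Real.norm_of_nonneg (by positivity)]
        exact Real.rpow_le_rpow (abs_nonneg _) (hθbdd z) (by linarith)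
      exact (norm_sub_le _ _).trans (add_le_add (hbound _) (hbound _))
    rw [← integral_const_mul, ← integral_const_mul]
    refine setIntegral_mono_on (hint₂.const_mul _) (hint₁.const_mul _)
      (measurableSet_lt measurable_const measurable_norm) fun y (hy : ε < ‖y‖) => ?_
    have hy0 : y ≠ 0 := norm_pos_iff.mp (hε.trans hy)
    have hconv := abs_rpow_sub_le_sign_mul hq (θ x) (θ (x + y))
    rw [hinv] at hconv
    rw [← mul_assoc, ← mul_assoc]
    exact mul_le_mul_of_nonneg_right hconv (hK3 y hy0)
  linarith
end

section
/- Let d ≥ 1, α ∈ (0,1], σ ∈ [0,α), and let K satisfy (K1), (K2) and (K3). Let θ : ℝ^d → ℝ be a bounded C² function with bounded Hessian, and suppose x₀ ∈ ℝ^d is a global maximum point of θ with θ(x₀) = sup_{ℝ^d} θ = ‖θ‖_{L^∞} > 0. Then the integrals ∫_{ℝ^d} (θ(x₀) − θ(x₀+y)) K(y) dy and ∫_{ℝ^d} (θ(x₀) − θ(x₀+y)) |y|^{−(d+α−σ)} dy converge absolutely (their integrands are nonnegative), and there exists a constant C > 0, depending only on d, α, σ, c₂, such that ∫_{ℝ^d}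 (θ(x₀) − θ(x₀+y)) K(y) dy ≥ c₂^{−1} ∫_{ℝ^d} (θ(x₀) − θ(x₀+y)) |y|^{−(d+α−σ)} dy − C ‖θ‖_{L^∞}. -/
open MeasureTheory Set

/-- A `C²` function whose second derivative is bounded by `M` stays within `M * ‖y‖ ^ 2` of its
value at a local maximum. -/
lemma IsLocalMax.sub_le_mul_norm_sq {E : Type*} [NormedAddCommGroup E] [NormedSpace ℝ E]
    {θ : E → ℝ} (hθ : ContDiff ℝ 2 θ) {M : ℝ} (hM : ∀ x, ‖fderiv ℝ (fderiv ℝ θ) x‖ ≤ M)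
    {x₀ : E} (hmax : IsLocalMax θ x₀) (y : E) : θ x₀ - θ (x₀ + y) ≤ M * ‖y‖ ^ 2 := by
  have hM0 : 0 ≤ M := (norm_nonneg (fderiv ℝ (fderiv ℝ θ) x₀)).trans (hM x₀)
  have hdiff : Differentiable ℝ (fderiv ℝ θ) :=
    (hθ.fderiv_right (m := 1) (by norm_num)).differentiable (by norm_num)
  have hfderiv (x : E) : ‖fderiv ℝ θ x‖ ≤ M * ‖x - x₀‖ := by
    have h := convex_univ.norm_image_sub_le_of_norm_fderiv_le (fun x _ => hdiff x)
      (fun x _ => hM x) (mem_univ x₀) (mem_univ x)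
    rwa [hmax.fderiv_eq_zero, sub_zero] at h
  have h := (convex_closedBall x₀ ‖y‖).norm_image_sub_le_of_norm_fderiv_le
    (f := θ) (C := M * ‖y‖) (x := x₀) (y := x₀ + y)
    (fun x _ => hθ.differentiable (by norm_num) x)
    (fun x hx => (hfderiv x).trans
      (mul_le_mul_of_nonneg_left (mem_closedBall_iff_norm.1 hx) hM0))
    (Metric.mem_closedBall_self (norm_nonneg y)) (by simp)
  rw [add_sub_cancel_left, Real.norm_eq_abs, abs_sub_comm] at h
  linarith [le_abs_self (θ x₀ - θ (x₀ + y))]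

lemma Real.rpow_neg_le_two_rpow_mul_one_add_rpow_neg {t r : ℝ} (ht : 1 ≤ t) (hr : 0 ≤ r) :
    t ^ (-r) ≤ 2 ^ r * (1 + t) ^ (-r) := by
  have h : ((1 + t) / 2) ^ (-r) = 2 ^ r * (1 + t) ^ (-r) := by
    rw [Real.div_rpow (by linarith) (by norm_num), Real.rpow_neg (by norm_num : (0 : ℝ) ≤ 2),
      div_inv_eq_mul, mul_comm]
  rw [← h]
  exact Real.rpow_le_rpow_of_nonpos (by linarith) (by linarith) (by linarith)

/-- coercivity at a global maximum point, inequalities (3.2)–(3.4) in the proof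
of Lemma 3.2: at a positive global maximum point `x₀` of a bounded `C²` function `θ` with
bounded Hessian (with `θ(x₀) = ‖θ‖_∞ > 0`), the nonnegative integrands `(θ(x₀)-θ(x₀+y))K(y)` and
`(θ(x₀)-θ(x₀+y))|y|^{-(d+α-σ)}` are integrable and
`∫(θ(x₀)-θ(x₀+y))K(y) dy ≥ c₂⁻¹ ∫(θ(x₀)-θ(x₀+y))|y|^{-(d+α-σ)} dy - C‖θ‖_∞`,
with `C > 0` depending only on `d, α, σ, c₂`. -/
theorem coercivity_at_maximum
    (d : ℕ) (hd : 1 ≤ d) (α σ c₂ : ℝ)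
    (hα0 : 0 < α) (hα1 : α ≤ 1) (hσ0 : 0 ≤ σ) (hσα : σ < α) (hc₂ : 1 ≤ c₂) :
    ∃ C : ℝ, 0 < C ∧
      ∀ c₁ : ℝ, 0 < c₁ →
      ∀ K : EuclideanSpace ℝ (Fin d) → ℝ,
        Measurable K →
        (∀ y : EuclideanSpace ℝ (Fin d), y ≠ 0 → K (-y) = K y) →
        Integrable (fun y : EuclideanSpace ℝ (Fin d) => min 1 (‖y‖ ^ 2) * |K y|) →
        (∫ y : EuclideanSpace ℝ (Fin d), min 1 (‖y‖ ^ 2) * |K y|) ≤ c₁ →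
        (∀ y : EuclideanSpace ℝ (Fin d), 0 < ‖y‖ → ‖y‖ ≤ 1 →
          c₂⁻¹ * ‖y‖ ^ (-((d : ℝ) + α - σ)) ≤ K y ∧ K y ≤ c₂ * ‖y‖ ^ (-((d : ℝ) + α))) →
        (∀ y : EuclideanSpace ℝ (Fin d), y ≠ 0 → 0 ≤ K y) →
      ∀ θ : EuclideanSpace ℝ (Fin d) → ℝ,
        ContDiff ℝ 2 θ →
        ∀ MH : ℝ, (∀ x, ‖fderiv ℝ (fderiv ℝ θ) x‖ ≤ MH) →
      ∀ x₀ : EuclideanSpace ℝ (Fin d),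
        (∀ x, |θ x| ≤ θ x₀) →
        0 < θ x₀ →
        Integrable (fun y : EuclideanSpace ℝ (Fin d) => (θ x₀ - θ (x₀ + y)) * K y) ∧
        Integrable (fun y : EuclideanSpace ℝ (Fin d) =>
          (θ x₀ - θ (x₀ + y)) * ‖y‖ ^ (-((d : ℝ) + α - σ))) ∧
        c₂⁻¹ * (∫ y : EuclideanSpace ℝ (Fin d),
              (θ x₀ - θ (x₀ + y)) * ‖y‖ ^ (-((d : ℝ) + α - σ))) - C * θ x₀
          ≤ ∫ y : EuclideanSpace ℝ (Fin d), (θ x₀ - θ (x₀ + y)) * K y := by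
  obtain ⟨r, hr⟩ : ∃ r, r = (d : ℝ) + α - σ := ⟨_, rfl⟩
  have hrd : (d : ℝ) < r := by linarith
  have hr0 : 0 ≤ r := (Nat.cast_nonneg d).trans hrd.le
  have hc : 0 < c₂ := by linarith
  rw [← hr]
  have hT : Integrable fun y : EuclideanSpace ℝ (Fin d) => 2 ^ r * (1 + ‖y‖) ^ (-r) :=
    (integrable_one_add_norm (by simpa using hrd)).const_mul _
  have hT0 (y : EuclideanSpace ℝ (Fin d)) : 0 ≤ 2 ^ r * (1 + ‖y‖) ^ (-r) := by positivity
  have hIT : 0 ≤ ∫ y : EuclideanSpace ℝ (Fin d), 2 ^ r * (1 + ‖y‖) ^ (-r) := integral_nonneg hT0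
  refine ⟨c₂⁻¹ * (2 * ∫ y : EuclideanSpace ℝ (Fin d), 2 ^ r * (1 + ‖y‖) ^ (-r)) + 1,
    by positivity, ?_⟩
  intro c₁ _ K hK _ hK1 _ hK2 hK3 θ hθ MH hMH x₀ hmax hpos
  have hg0 (y) : 0 ≤ θ x₀ - θ (x₀ + y) := by linarith [le_abs_self (θ (x₀ + y)), hmax (x₀ + y)]
  have hg2 (y) : θ x₀ - θ (x₀ + y) ≤ 2 * θ x₀ := by
    linarith [neg_abs_le (θ (x₀ + y)), hmax (x₀ + y)]
  have hlocal : IsLocalMax θ x₀ :=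
    Filter.Eventually.of_forall fun x => (le_abs_self _).trans (hmax x)
  obtain ⟨M, hM⟩ : ∃ M, M = max (2 * θ x₀) MH := ⟨_, rfl⟩
  have hM0 : 0 ≤ M := by rw [hM]; exact le_max_of_le_left (by linarith)
  have hgM (y) : θ x₀ - θ (x₀ + y) ≤ M * min 1 (‖y‖ ^ 2) := by
    rw [mul_min_of_nonneg _ _ hM0, le_min_iff, mul_one, hM]
    exact ⟨(hg2 y).trans (le_max_left _ _), (hlocal.sub_le_mul_norm_sq hθ hMH y).trans
      (mul_le_mul_of_nonneg_right (le_max_right _ _) (by positivity))⟩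
  have hgmeas : Measurable fun y => θ x₀ - θ (x₀ + y) := by
    have := hθ.continuous
    exact Continuous.measurable (by fun_prop)
  have hPmeas : Measurable fun y : EuclideanSpace ℝ (Fin d) => ‖y‖ ^ (-r) := by fun_prop
  have hgK0 (y) : 0 ≤ (θ x₀ - θ (x₀ + y)) * K y := by
    rcases eq_or_ne y 0 with rfl | hy
    · simp
    · exact mul_nonneg (hg0 y) (hK3 y hy)
  have hbound (y) : (θ x₀ - θ (x₀ + y)) * ‖y‖ ^ (-r) ≤
      c₂ * ((θ x₀ - θ (x₀ + y)) * K y) + 2 * θ x₀ * (2 ^ r * (1 + ‖y‖) ^ (-r)) := by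
    have hgT : 0 ≤ 2 * θ x₀ * (2 ^ r * (1 + ‖y‖) ^ (-r)) := mul_nonneg (by linarith) (hT0 y)
    rcases eq_or_ne y 0 with rfl | hy
    · simpa using hgT
    rcases le_or_gt ‖y‖ 1 with h | h
    · have hPK := (hK2 y (norm_pos_iff.2 hy) h).1
      rw [inv_mul_le_iff₀ hc] at hPK
      linarith [mul_le_mul_of_nonneg_left hPK (hg0 y)]
    · have hPT := mul_le_mul (hg2 y)
        (Real.rpow_neg_le_two_rpow_mul_one_add_rpow_neg h.le hr0)
        (Real.rpow_nonneg (norm_nonneg y) _) (by linarith)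
      linarith [mul_nonneg hc.le (hgK0 y)]
  have hgK : Integrable fun y => (θ x₀ - θ (x₀ + y)) * K y := by
    refine (hK1.const_mul M).mono' (hgmeas.mul hK).aestronglyMeasurable (.of_forall fun y => ?_)
    rw [norm_mul, Real.norm_of_nonneg (hg0 y), Real.norm_eq_abs, ← mul_assoc]
    exact mul_le_mul_of_nonneg_right (hgM y) (abs_nonneg _)
  have hsum := (hgK.const_mul c₂).add (hT.const_mul (2 * θ x₀))
  have hgP : Integrable fun y => (θ x₀ - θ (x₀ + y)) * ‖y‖ ^ (-r) := by
    refine hsum.mono' (hgmeas.mul hPmeas).aestronglyMeasurable (.of_forall fun y => ?_)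
    rw [Real.norm_of_nonneg (mul_nonneg (hg0 y) (Real.rpow_nonneg (norm_nonneg y) _))]
    exact hbound y
  refine ⟨hgK, hgP, ?_⟩
  have h := integral_mono hgP hsum hbound
  simp only [Pi.add_apply] at h
  rw [integral_add (hgK.const_mul c₂) (hT.const_mul (2 * θ x₀)), integral_const_mul c₂,
    integral_const_mul (2 * θ x₀)] at h
  have h' := mul_le_mul_of_nonneg_left h (inv_pos.2 hc).le
  rw [mul_add, inv_mul_cancel_left₀ hc.ne'] at h'
  linarith
end
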